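/- Let V be a finite-dimensional real vector space, T : V → V a linear automorphism, and c ∈ ℝ. Then for every v ∈ V there exists a smooth (infinitely differentiable) ℤ-invariant function σ : ℝ → V such that ∫₀¹ e^{-ct}·σ(t) dt = v. In other words, the linear map sending a smooth ℤ-invariant function σ : ℝ → V to ∫₀¹ e^{-ct}·σ(t) dt ∈ V is surjective. -/

import Mathlib

open MeasureTheory intervalIntegral

/-- The extension of `h` from `[0, 1)` to `ℝ` satisfying `T (σ (t + 1)) = σ t`. -/
noncomputable def equivariantExtension {V : Type*} [AddCommGroup V] [Module ℝ V]
    (T : V ≃ₗ[ℝ] V) (h : ℝ → V) (t : ℝ) : V :=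
  (T ^ (-⌊t⌋)) (h (Int.fract t))

theorem apply_equivariantExtension_add_one {V : Type*} [AddCommGroup V] [Module ℝ V]
    (T : V ≃ₗ[ℝ] V) (h : ℝ → V) (t : ℝ) :
    T (equivariantExtension T h (t + 1)) = equivariantExtension T h t := by
  have hT : T * T ^ (-(⌊t⌋ + 1)) = T ^ (-⌊t⌋) := by
    rw [← zpow_one_add]
    congr 1
    ring
  simp only [equivariantExtension, Int.floor_add_one, Int.fract_add_one]
  rw [← LinearEquiv.mul_apply, hT]

theorem contDiff_equivariantExtension {V : Type*} [NormedAddCommGroup V] [NormedSpace ℝ V]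
    [FiniteDimensional ℝ V] (T : V ≃ₗ[ℝ] V) {h : ℝ → V} {n : WithTop ℕ∞}
    (hh : ContDiff ℝ n h) {b : ℝ} (hb : b < 1)
    (h_nonpos : ∀ t ≤ 0, h t = 0) (h_ge : ∀ t, b ≤ t → h t = 0) :
    ContDiff ℝ n (equivariantExtension T h) := by
  rw [contDiff_iff_contDiffAt]
  intro t
  have hloc : ContDiffAt ℝ n (fun s ↦ (T ^ (-⌊t⌋)) (h (s - ⌊t⌋))) t :=
    ((T ^ (-⌊t⌋)).toContinuousLinearEquiv.contDiff.comp
      (hh.comp (contDiff_id.sub contDiff_const))).contDiffAt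
  refine hloc.congr_of_eventuallyEq ?_
  have hlow : max (⌊t⌋ - 1 + b) (⌊t⌋ - 1) < t :=
    max_lt (by linarith [Int.floor_le t]) (by linarith [Int.floor_le t])
  filter_upwards [Ioo_mem_nhds hlow (Int.lt_floor_add_one t)] with s hs
  obtain ⟨hs₁, hs₂⟩ := hs
  obtain ⟨hsb, hs₁⟩ := max_lt_iff.mp hs₁
  rcases le_or_gt (⌊t⌋ : ℝ) s with hts | hts
  · have hfloor : ⌊s⌋ = ⌊t⌋ := Int.floor_eq_iff.mpr ⟨hts, hs₂⟩
    simp only [equivariantExtension, Int.fract, hfloor]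
  · have hfloor : ⌊s⌋ = ⌊t⌋ - 1 :=
      Int.floor_eq_iff.mpr ⟨by push_cast; exact hs₁.le, by push_cast; linarith⟩
    have hfract : h (Int.fract s) = 0 := by
      refine h_ge _ ?_
      rw [Int.fract, hfloor]
      push_cast
      linarith
    simp only [equivariantExtension, hfract, h_nonpos (s - ⌊t⌋) (by linarith), map_zero]

theorem exists_contDiff_integral_eq_one {a b : ℝ} (hab : a < b) :
    ∃ φ : ℝ → ℝ, ContDiff ℝ (⊤ : ℕ∞) φ ∧ (∀ t ≤ a, φ t = 0) ∧ (∀ t, b ≤ t → φ t = 0) ∧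
      ∫ t in a..b, φ t = 1 := by
  let f : ContDiffBump ((a + b) / 2) :=
    ⟨(b - a) / 4, (b - a) / 2, by linarith, by linarith⟩
  have hsupp : Function.support (f.normed volume) = Set.Ioo a b := by
    rw [f.support_normed_eq, Real.ball_eq_Ioo]
    congr 1 <;> ring
  have hzero : ∀ t ∉ Set.Ioo a b, f.normed volume t = 0 := fun t ht ↦
    Function.notMem_support.mp (hsupp ▸ ht)
  refine ⟨f.normed volume, f.contDiff_normed, fun t ht ↦ hzero t fun h ↦ ht.not_gt h.1,
    fun t ht ↦ hzero t fun h ↦ ht.not_gt h.2, ?_⟩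
  rw [integral_eq_integral_of_support_subset (hsupp ▸ Set.Ioo_subset_Ioc_self),
    f.integral_normed]

/-- Let `V` be a finite-dimensional real vector space, `T : V ≃ₗ[ℝ] V`
a linear automorphism and `c ∈ ℝ`. For every `v ∈ V` there exists a smooth `ℤ`-invariant
function `σ : ℝ → V` (i.e. `T (σ (t+1)) = σ t`) such that `∫₀¹ e^{-ct} • σ t dt = v`. -/
theorem stmt5 {V : Type*} [NormedAddCommGroup V] [NormedSpace ℝ V]
    [FiniteDimensional ℝ V] (T : V ≃ₗ[ℝ] V) (c : ℝ) (v : V) :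
    ∃ σ : ℝ → V, ContDiff ℝ (⊤ : ℕ∞) σ ∧ (∀ t : ℝ, T (σ (t + 1)) = σ t) ∧
      (∫ t in (0:ℝ)..1, Real.exp (-c * t) • σ t) = v := by
  obtain ⟨φ, hφ, hφ_nonpos, hφ_ge, hφ_int⟩ :=
    exists_contDiff_integral_eq_one (a := 0) (b := 1 / 2) (by norm_num)
  let h : ℝ → V := fun t ↦ (Real.exp (c * t) * φ t) • v
  have hh : ContDiff ℝ (⊤ : ℕ∞) h :=
    ((Real.contDiff_exp.comp (contDiff_const.mul contDiff_id)).mul hφ).smul contDiff_const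
  have h_ge : ∀ t, 1 / 2 ≤ t → h t = 0 := fun t ht ↦ by simp [h, hφ_ge t ht]
  refine ⟨equivariantExtension T h,
    contDiff_equivariantExtension T hh (b := 1 / 2) (by norm_num)
      (fun t ht ↦ by simp [h, hφ_nonpos t ht]) h_ge,
    apply_equivariantExtension_add_one T h, ?_⟩
  have hint : ∀ t ∈ Set.Ioo (0 : ℝ) 1,
      Real.exp (-c * t) • equivariantExtension T h t = φ t • v := by
    intro t ht
    have hfloor : ⌊t⌋ = 0 := Int.floor_eq_zero_iff.mpr ⟨ht.1.le, ht.2⟩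
    simp only [equivariantExtension, Int.fract, hfloor, h, neg_zero, zpow_zero, Int.cast_zero,
      sub_zero, LinearEquiv.coe_one, id_eq, smul_smul]
    rw [← mul_assoc, ← Real.exp_add, neg_mul, neg_add_cancel, Real.exp_zero, one_mul]
  have hφ_tail : ∫ t in (1 / 2 : ℝ)..1, φ t = 0 := by
    rw [integral_congr (g := fun _ ↦ 0), intervalIntegral.integral_zero]
    intro t ht
    rw [Set.uIcc_of_le (by norm_num)] at ht
    exact hφ_ge t ht.1
  rw [integral_congr_Ioo_of_le zero_le_one hint,
    intervalIntegral.integral_smul_const,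
    ← integral_add_adjacent_intervals (hφ.continuous.intervalIntegrable 0 (1 / 2))
      (hφ.continuous.intervalIntegrable _ _), hφ_int, hφ_tail, add_zero, one_smul]
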